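/- Let μ₀ be a nonatomic Borel probability measure on ℝ supported in (−∞, a) for some a ∈ ℝ, let p ∈ (0,1), and set μ := (1 − p) μ₀ + p δ_a. Let x₀ ∈ ℝ and let ρ be a Borel probability measure supported in (−∞, x₀), and set ν := p δ_{x₀} + (1 − p) ρ. Define F : ℝ → ℝ by F(x) := Q_ρ(F_{μ₀}(x)) for x < a and F(x) := x₀ for x ≥ a, where F_{μ₀} is the cumulative distribution function of μ₀ and Q_ρ the quantile function of ρ. Then F is nondecreasing and F_# μ = ν. -/

import Mathlib

open MeasureTheory

/-- The CDF of a Borel measure on `ℝ`, as a real-valued function. -/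
noncomputable def cdf (μ : Measure ℝ) (x : ℝ) : ℝ := (μ (Set.Iic x)).toReal

/-- The quantile function `Q_μ(u) = inf {x | F_μ(x) ≥ u}` (generalized inverse of the CDF). -/
noncomputable def quantile (μ : Measure ℝ) (u : ℝ) : ℝ := sInf {x : ℝ | u ≤ cdf μ x}

open Filter Topology

theorem cdf_eq_probabilityTheory_cdf (μ : Measure ℝ) [IsProbabilityMeasure μ] :
    cdf μ = ProbabilityTheory.cdf μ :=
  funext fun x => (ProbabilityTheory.cdf_eq_real μ x).symm

theorem monotone_cdf (μ : Measure ℝ) [IsProbabilityMeasure μ] : Monotone (cdf μ) := by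
  rw [cdf_eq_probabilityTheory_cdf]
  exact ProbabilityTheory.monotone_cdf μ

theorem cdf_nonneg (μ : Measure ℝ) (x : ℝ) : 0 ≤ cdf μ x := ENNReal.toReal_nonneg

theorem cdf_le_one (μ : Measure ℝ) [IsProbabilityMeasure μ] (x : ℝ) : cdf μ x ≤ 1 := by
  rw [cdf_eq_probabilityTheory_cdf]
  exact ProbabilityTheory.cdf_le_one μ x

theorem tendsto_cdf_atBot (μ : Measure ℝ) [IsProbabilityMeasure μ] :
    Tendsto (cdf μ) atBot (𝓝 0) := by
  rw [cdf_eq_probabilityTheory_cdf]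
  exact ProbabilityTheory.tendsto_cdf_atBot μ

theorem tendsto_cdf_atTop (μ : Measure ℝ) [IsProbabilityMeasure μ] :
    Tendsto (cdf μ) atTop (𝓝 1) := by
  rw [cdf_eq_probabilityTheory_cdf]
  exact ProbabilityTheory.tendsto_cdf_atTop μ

theorem ofReal_cdf (μ : Measure ℝ) [IsProbabilityMeasure μ] (x : ℝ) :
    ENNReal.ofReal (cdf μ x) = μ (Set.Iic x) :=
  ENNReal.ofReal_toReal (measure_ne_top _ _)

theorem cdf_eq_one_of_measure_Ici_eq_zero (μ : Measure ℝ) [IsProbabilityMeasure μ] {b : ℝ}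
    (h : μ (Set.Ici b) = 0) : cdf μ b = 1 := by
  have hc : μ (Set.Iic b)ᶜ = 0 :=
    measure_mono_null (fun x hx => (not_le.1 (Set.mem_Iic.not.1 hx)).le) h
  rw [cdf, (prob_compl_eq_zero_iff measurableSet_Iic).1 hc, ENNReal.toReal_one]

theorem continuous_cdf (μ : Measure ℝ) [IsProbabilityMeasure μ] (h : ∀ x, μ {x} = 0) :
    Continuous (cdf μ) := by
  rw [cdf_eq_probabilityTheory_cdf, continuous_iff_continuousAt]
  intro x
  have hmono := ProbabilityTheory.monotone_cdf μ
  rw [hmono.continuousAt_iff_leftLim_eq_rightLim, StieltjesFunction.rightLim_eq]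
  have hx := h x
  rw [← ProbabilityTheory.measure_cdf μ, StieltjesFunction.measure_singleton,
    ENNReal.ofReal_eq_zero] at hx
  exact le_antisymm (hmono.leftLim_le le_rfl) (by linarith)

/-- The CDF of a nonatomic probability measure transports it to the uniform law. -/
theorem measure_cdf_le (μ : Measure ℝ) [IsProbabilityMeasure μ] (h : ∀ x, μ {x} = 0) {c : ℝ}
    (hc₀ : 0 ≤ c) (hc₁ : c ≤ 1) : μ {x | cdf μ x ≤ c} = ENNReal.ofReal c := by
  rcases hc₁.eq_or_lt with rfl | hc₁
  · simp [cdf_le_one]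
  have hcont := continuous_cdf μ h
  obtain ⟨b, hb⟩ := ((tendsto_cdf_atTop μ).eventually (lt_mem_nhds hc₁)).exists
  set S : Set ℝ := {x | cdf μ x ≤ c}
  have hS_bdd : BddAbove S :=
    ⟨b, fun x hx => le_of_not_gt fun hbx =>
      absurd (hb.trans_le (monotone_cdf μ hbx.le)) (not_lt.2 hx)⟩
  have hattain : 0 < c → ∃ z, cdf μ z = c := fun hc => by
    obtain ⟨l, hl⟩ := ((tendsto_cdf_atBot μ).eventually (gt_mem_nhds hc)).exists
    exact mem_range_of_exists_le_of_exists_ge hcont ⟨l, hl.le⟩ ⟨b, hb.le⟩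
  rcases S.eq_empty_or_nonempty with hS | hS
  · rcases hc₀.eq_or_lt with rfl | hc
    · simp [hS]
    · obtain ⟨z, hz⟩ := hattain hc
      exact absurd (show z ∈ S from hz.le) (by simp [hS])
  have hmem : sSup S ∈ S := (isClosed_le hcont continuous_const).csSup_mem hS hS_bdd
  have hIic : S = Set.Iic (sSup S) :=
    Set.Subset.antisymm (fun x hx => le_csSup hS_bdd hx)
      fun x hx => (monotone_cdf μ hx).trans hmem
  have hval : cdf μ (sSup S) = c := by
    refine le_antisymm hmem ?_
    rcases hc₀.eq_or_lt with rfl | hc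
    · exact cdf_nonneg μ _
    · obtain ⟨z, hz⟩ := hattain hc
      exact hz.ge.trans (monotone_cdf μ (le_csSup hS_bdd hz.le))
  rw [hIic, ← ofReal_cdf, hval]

theorem ae_cdf_pos (μ : Measure ℝ) [IsProbabilityMeasure μ] (h : ∀ x, μ {x} = 0) :
    ∀ᵐ x ∂μ, 0 < cdf μ x := by
  simpa [ae_iff] using measure_cdf_le μ h le_rfl zero_le_one

theorem bddBelow_le_cdf (μ : Measure ℝ) [IsProbabilityMeasure μ] {u : ℝ} (hu : 0 < u) :
    BddBelow {x | u ≤ cdf μ x} := by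
  obtain ⟨l, hl⟩ := ((tendsto_cdf_atBot μ).eventually (gt_mem_nhds hu)).exists
  exact ⟨l, fun x hx => le_of_not_gt fun hxl =>
    absurd ((monotone_cdf μ hxl.le).trans_lt hl) (not_lt.2 hx)⟩

theorem quantile_le_iff (μ : Measure ℝ) [IsProbabilityMeasure μ] {u : ℝ} (hu : 0 < u)
    (hne : {x | u ≤ cdf μ x}.Nonempty) {t : ℝ} : quantile μ u ≤ t ↔ u ≤ cdf μ t := by
  refine ⟨fun h => ?_, fun h => csInf_le (bddBelow_le_cdf μ hu) h⟩
  have hright : Tendsto (cdf μ) (𝓝[>] t) (𝓝 (cdf μ t)) := by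
    rw [cdf_eq_probabilityTheory_cdf]
    exact ((ProbabilityTheory.cdf μ).right_continuous t).mono_left
      (nhdsWithin_mono t Set.Ioi_subset_Ici_self)
  refine ge_of_tendsto hright (eventually_nhdsWithin_of_forall fun s hs => ?_)
  obtain ⟨x, hx, hxs⟩ := exists_lt_of_csInf_lt hne (h.trans_lt hs)
  exact le_trans hx (monotone_cdf μ hxs.le)

/-- sufficiency direction for the Cramér–Lundberg attainability condition:
for `μ = (1−p)μ₀ + pδ_a` with `μ₀` nonatomic and supported in `(−∞, a)`, and
`ν = pδ_{x₀} + (1−p)ρ` with `ρ` supported in `(−∞, x₀)`, the map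
`F(x) = Q_ρ(F_{μ₀}(x))` for `x < a`, `F(x) = x₀` for `x ≥ a`, is nondecreasing
(on the set where the quantile function of `ρ`, defined on `(0,1]`, is evaluated within
its domain; its complement `{x < a | F_{μ₀}(x) = 0}` is a `μ`-null initial segment)
and pushes `μ` forward to `ν`. -/
theorem cramer_lundberg_attainable
    (μ₀ : Measure ℝ) [IsProbabilityMeasure μ₀] (h_atoms : ∀ x : ℝ, μ₀ {x} = 0)
    (a : ℝ) (h_supp₀ : μ₀ (Set.Ici a) = 0)
    (p : ℝ) (hp : p ∈ Set.Ioo (0:ℝ) 1)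
    (x₀ : ℝ) (ρ : Measure ℝ) [IsProbabilityMeasure ρ] (h_suppρ : ρ (Set.Ici x₀) = 0)
    (μ ν : Measure ℝ)
    (hμ : μ = ENNReal.ofReal (1 - p) • μ₀ + ENNReal.ofReal p • Measure.dirac a)
    (hν : ν = ENNReal.ofReal p • Measure.dirac x₀ + ENNReal.ofReal (1 - p) • ρ)
    (F : ℝ → ℝ) (hF : F = fun x => if x < a then quantile ρ (cdf μ₀ x) else x₀) :
    MonotoneOn F {x : ℝ | a ≤ x ∨ 0 < cdf μ₀ x} ∧ Measure.map F μ = ν := by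
  have hne : ∀ x, {y | cdf μ₀ x ≤ cdf ρ y}.Nonempty := fun x =>
    ⟨x₀, (cdf_le_one μ₀ x).trans (cdf_eq_one_of_measure_Ici_eq_zero ρ h_suppρ).ge⟩
  have hmono : MonotoneOn F {x : ℝ | a ≤ x ∨ 0 < cdf μ₀ x} := by
    intro x hx y _ hxy
    rw [hF]
    dsimp only
    split_ifs with hxa hya hya
    · have hpos := hx.resolve_left (not_le.2 hxa)
      exact csInf_le_csInf (bddBelow_le_cdf ρ hpos) (hne y)
        fun z hz => (monotone_cdf μ₀ hxy).trans hz
    · have hpos := hx.resolve_left (not_le.2 hxa)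
      exact (quantile_le_iff ρ hpos (hne x)).2
        ((cdf_le_one μ₀ x).trans (cdf_eq_one_of_measure_Ici_eq_zero ρ h_suppρ).ge)
    · exact absurd (hxy.trans_lt hya) hxa
    · exact le_rfl
  refine ⟨hmono, ?_⟩
  have hlt : ∀ᵐ x ∂μ₀, x < a := by simpa [ae_iff, Set.Ici] using h_supp₀
  have hdomain : ∀ᵐ x ∂μ, x ∈ {x : ℝ | a ≤ x ∨ 0 < cdf μ₀ x} := by
    rw [hμ, ae_add_measure_iff]
    refine ⟨Measure.ae_smul_measure ?_ _, Measure.ae_smul_measure ?_ _⟩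
    · exact (ae_cdf_pos μ₀ h_atoms).mono fun x hx => Or.inr hx
    · simp [ae_dirac_eq]
  have hmeas : MeasurableSet {x : ℝ | a ≤ x ∨ 0 < cdf μ₀ x} :=
    measurableSet_Ici.union (measurableSet_lt measurable_const (monotone_cdf μ₀).measurable)
  have hF_meas : AEMeasurable F μ := by
    rw [← Measure.restrict_eq_self_of_ae_mem hdomain]
    exact aemeasurable_restrict_of_monotoneOn hmeas hmono
  have : IsFiniteMeasure μ := by
    rw [hμ]
    have := Measure.smul_finite μ₀ (c := ENNReal.ofReal (1 - p)) ENNReal.ofReal_ne_top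
    have := Measure.smul_finite (Measure.dirac a) (c := ENNReal.ofReal p) ENNReal.ofReal_ne_top
    infer_instance
  have hμ₀ : ∀ t, μ₀ (F ⁻¹' Set.Iic t) = ρ (Set.Iic t) := by
    intro t
    rw [← ofReal_cdf, ← measure_cdf_le μ₀ h_atoms (cdf_nonneg ρ t) (cdf_le_one ρ t)]
    refine measure_congr ?_
    filter_upwards [hlt, ae_cdf_pos μ₀ h_atoms] with x hxa hx
    refine propext ?_
    change F x ≤ t ↔ cdf μ₀ x ≤ cdf ρ t
    rw [hF]
    simpa only [if_pos hxa] using quantile_le_iff ρ hx (hne x)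
  have hFa : F a = x₀ := by simp [hF]
  refine Measure.ext_of_Iic _ _ fun t => ?_
  rw [Measure.map_apply_of_aemeasurable hF_meas measurableSet_Iic, hμ, hν]
  simp only [Measure.add_apply, Measure.smul_apply, hμ₀, Measure.dirac_apply]
  rw [add_comm]
  simp [Set.indicator, hFa]
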